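/- arXiv:1612.05182 — 4 statements merged into one kernel-verified Lean document; each statement's English description precedes it below -/
import Mathlib

section
/- Let n ≥ 1 and k ≥ 0. Every linear functional φ : W_k → 𝕜 that is invariant under the alternating group (i.e. φ(σ • g) = φ(g) for every even permutation σ ∈ Perm (Fin n) and every g ∈ W_k) is a 𝕜-linear combination of the following functionals: (i) the functionals Φ_P, where P ranges over all set partitions of Fin k; (ii) the functionals J_{p,r}, where p ranges over surjections Fin k → Fin n and r over sections of p; and (iii) the functionals J'_{p,r}, where p ranges over surjections Fin k → Fin (n−1) and r over sections of p. (This is the concrete content of Theorem A, the fullness of Ψ : JP(n) → Rep(A_n), for Hom-spaces into the unit object.) -/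
open scoped Classical

noncomputable section

namespace Jellyfish

variable {𝕜 : Type*} [Field 𝕜]

/-- The indicator (delta) function `δ_i` of a tuple `i`, a basis vector of
`W = (ι → Fin n) → 𝕜`. -/
def delta {ι : Type*} {n : ℕ} (i : ι → Fin n) : (ι → Fin n) → 𝕜 :=
  fun j => if j = i then 1 else 0

/-- The linear action of `Equiv.Perm (Fin n)` on `(ι → Fin n) → 𝕜`; it satisfies
`permAct σ (delta i) = delta (σ ∘ i)`. -/
def permAct {ι : Type*} {n : ℕ} (σ : Equiv.Perm (Fin n)) (g : (ι → Fin n) → 𝕜) :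
    (ι → Fin n) → 𝕜 :=
  fun j => g (⇑σ.symm ∘ j)

/-- `DET i`: the determinant of the `n × n` matrix whose `b`-th column is the standard
basis vector `e_{i b}`; entry `(a,b)` is `1` if `i b = a` and `0` otherwise. -/
def DET {n : ℕ} (i : Fin n → Fin n) : 𝕜 :=
  Matrix.det (Matrix.of fun a b => if i b = a then (1 : 𝕜) else 0)

/-- `a` and `b` lie in a common block of the set partition `P`. -/
def sameBlock {ι : Type*} [DecidableEq ι] [Fintype ι]
    (P : Finpartition (Finset.univ : Finset ι)) (a b : ι) : Prop :=
  ∃ B ∈ P.parts, a ∈ B ∧ b ∈ B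

/-- The tuple `i` is constant on every block of the set partition `P`. -/
def constOnBlocks {ι : Type*} [DecidableEq ι] [Fintype ι] {n : ℕ}
    (P : Finpartition (Finset.univ : Finset ι)) (i : ι → Fin n) : Prop :=
  ∀ a b : ι, sameBlock P a b → i a = i b

/-- The kernel (partition into fibers) of the map `p` equals the set partition `P`. -/
def kernelEq {ι : Type*} [DecidableEq ι] [Fintype ι] {m : ℕ}
    (p : ι → Fin m) (P : Finpartition (Finset.univ : Finset ι)) : Prop :=
  ∀ a b : ι, p a = p b ↔ sameBlock P a b

/-- The linear functional `Φ_P` with `Φ_P (δ_i) = 1` if `i` is constant on every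
block of `P`, and `0` otherwise. -/
def PhiP {k n : ℕ} (P : Finpartition (Finset.univ : Finset (Fin k))) :
    ((Fin k → Fin n) → 𝕜) →ₗ[𝕜] 𝕜 :=
  ∑ i : Fin k → Fin n,
    (if constOnBlocks P i then (1 : 𝕜) else 0) •
      (LinearMap.proj i : ((Fin k → Fin n) → 𝕜) →ₗ[𝕜] 𝕜)

/-- The linear functional `f_P` with `f_P (δ_i) = 1` if the kernel of `i` equals `P`,
and `0` otherwise. -/
def fP {k n : ℕ} (P : Finpartition (Finset.univ : Finset (Fin k))) :
    ((Fin k → Fin n) → 𝕜) →ₗ[𝕜] 𝕜 :=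
  ∑ i : Fin k → Fin n,
    (if kernelEq i P then (1 : 𝕜) else 0) •
      (LinearMap.proj i : ((Fin k → Fin n) → 𝕜) →ₗ[𝕜] 𝕜)

/-- The jellyfish functional `J_{p,r}`: `J_{p,r} (δ_i) = DET (i ∘ r)` if `i` is constant
on every fiber of `p`, and `0` otherwise. -/
def Jf {k n : ℕ} (p : Fin k → Fin n) (r : Fin n → Fin k) :
    ((Fin k → Fin n) → 𝕜) →ₗ[𝕜] 𝕜 :=
  ∑ i : Fin k → Fin n,
    (if ∀ a b : Fin k, p a = p b → i a = i b then DET (i ∘ r) else (0 : 𝕜)) •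
      (LinearMap.proj i : ((Fin k → Fin n) → 𝕜) →ₗ[𝕜] 𝕜)

/-- The `n × n` matrix `M(i)` whose column `c`, for `c : Fin (n-1)` embedded as the first
`n-1` columns, is the standard basis vector `e_{i (r c)}`, and whose last column is the
all-ones vector. -/
def Mmat {k n : ℕ} (r : Fin (n - 1) → Fin k) (i : Fin k → Fin n) :
    Matrix (Fin n) (Fin n) 𝕜 :=
  Matrix.of fun a b =>
    if h : (b : ℕ) < n - 1 then (if i (r ⟨(b : ℕ), h⟩) = a then 1 else 0) else 1

/-- The jellyfish functional `J'_{p,r}` (one dangling leg): `J'_{p,r} (δ_i) = det M(i)`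
if `i` is constant on every fiber of `p`, and `0` otherwise. -/
def Jf' {k n : ℕ} (p : Fin k → Fin (n - 1)) (r : Fin (n - 1) → Fin k) :
    ((Fin k → Fin n) → 𝕜) →ₗ[𝕜] 𝕜 :=
  ∑ i : Fin k → Fin n,
    (if ∀ a b : Fin k, p a = p b → i a = i b then (Mmat r i).det else (0 : 𝕜)) •
      (LinearMap.proj i : ((Fin k → Fin n) → 𝕜) →ₗ[𝕜] 𝕜)

/-- The linear map `T_P : W_k → W_ℓ` with `(T_P δ_i) (i') = 1` if `Sum.elim i i'` is
constant on every block of `P`, and `0` otherwise. -/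
def TP {k l n : ℕ} (P : Finpartition (Finset.univ : Finset (Fin k ⊕ Fin l))) :
    ((Fin k → Fin n) → 𝕜) →ₗ[𝕜] ((Fin l → Fin n) → 𝕜) :=
  ∑ i : Fin k → Fin n, ∑ i' : Fin l → Fin n,
    (if constOnBlocks P (Sum.elim i i') then (1 : 𝕜) else 0) •
      ((LinearMap.single 𝕜 (fun _ : Fin l → Fin n => 𝕜) i').comp
        (LinearMap.proj i : ((Fin k → Fin n) → 𝕜) →ₗ[𝕜] 𝕜))

/-- The subspace of linear functionals on `(ι → Fin n) → 𝕜` invariant under all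
permutations in `S`. -/
def invariantDual (𝕜 : Type*) [Field 𝕜] (ι : Type*) {n : ℕ}
    (S : Set (Equiv.Perm (Fin n))) :
    Submodule 𝕜 (((ι → Fin n) → 𝕜) →ₗ[𝕜] 𝕜) where
  carrier := {φ | ∀ σ ∈ S, ∀ g : (ι → Fin n) → 𝕜, φ (permAct σ g) = φ g}
  add_mem' := by
    intro φ ψ hφ hψ σ hσ g
    simp only [LinearMap.add_apply, hφ σ hσ g, hψ σ hσ g]
  zero_mem' := by intro σ hσ g; simp
  smul_mem' := by
    intro c φ hφ σ hσ g
    simp only [LinearMap.smul_apply, hφ σ hσ g]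

/-- The subspace of linear maps `W_k → W_ℓ` commuting with the actions of all
permutations in `S`. -/
def equivariantMaps (𝕜 : Type*) [Field 𝕜] (k l : ℕ) {n : ℕ}
    (S : Set (Equiv.Perm (Fin n))) :
    Submodule 𝕜 (((Fin k → Fin n) → 𝕜) →ₗ[𝕜] ((Fin l → Fin n) → 𝕜)) where
  carrier := {T | ∀ σ ∈ S, ∀ g : (Fin k → Fin n) → 𝕜, T (permAct σ g) = permAct σ (T g)}
  add_mem' := by
    intro T T' hT hT' σ hσ g
    funext j
    simp [LinearMap.add_apply, hT σ hσ g, hT' σ hσ g, permAct]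
  zero_mem' := by intro σ hσ g; funext j; simp [permAct]
  smul_mem' := by
    intro c T hT σ hσ g
    funext j
    simp [LinearMap.smul_apply, hT σ hσ g, permAct]

end Jellyfish

open Jellyfish

namespace Jellyfish

/-- Two tuples with the same kernel differ by a permutation of the values. -/
lemma exists_perm_comp_eq {ι : Type*} {n : ℕ} {i j : ι → Fin n}
    (h : ∀ a b, i a = i b ↔ j a = j b) : ∃ σ : Equiv.Perm (Fin n), j = σ ∘ i := by
  let e : {x // x ∈ Set.range i} ≃ {x // x ∈ Set.range j} :=
    (Setoid.quotientKerEquivRange i).symm.trans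
      ((Quotient.congrRight (fun a b => h a b)).trans (Setoid.quotientKerEquivRange j))
  refine ⟨e.extendSubtype, funext fun a => ?_⟩
  have ha : (Setoid.quotientKerEquivRange i).symm ⟨i a, a, rfl⟩ = Quotient.mk (Setoid.ker i) a :=
    (Equiv.symm_apply_eq _).2 rfl
  rw [Function.comp_apply, e.extendSubtype_apply_of_mem _ ⟨a, rfl⟩]
  simp only [e, Equiv.trans_apply, ha]
  rfl

/-- `f` transforms by the character `χ` under permutations of the values. -/
def SemiInvariant {𝕜 ι : Type*} [Field 𝕜] {n : ℕ} (χ : Equiv.Perm (Fin n) → 𝕜)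
    (f : (ι → Fin n) → 𝕜) : Prop :=
  ∀ (σ : Equiv.Perm (Fin n)) (j : ι → Fin n), f (σ ∘ j) = χ σ * f j

/-- A submodule contains every semi-invariant function as soon as it contains, for each tuple in
the support of one, a semi-invariant function supported exactly on the orbit of that tuple. -/
lemma SemiInvariant.mem_of_orbit {𝕜 ι : Type*} [Field 𝕜] [Finite ι] {n : ℕ}
    {χ : Equiv.Perm (Fin n) → 𝕜} {S : Submodule 𝕜 ((ι → Fin n) → 𝕜)}
    (hS : ∀ f, SemiInvariant χ f → ∀ i, f i ≠ 0 → ∃ ψ ∈ S, SemiInvariant χ ψ ∧ ψ i ≠ 0 ∧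
      ∀ j, ψ j ≠ 0 → ∀ a b, i a = i b ↔ j a = j b)
    {f : (ι → Fin n) → 𝕜} (hf : SemiInvariant χ f) : f ∈ S := by
  induction hs : (Function.support f).ncard using Nat.strong_induction_on generalizing f with
  | _ m ih =>
  by_cases h0 : f = 0
  · exact h0 ▸ S.zero_mem
  obtain ⟨i, hi⟩ := Function.ne_iff.1 h0
  obtain ⟨ψ, hψS, hψ, hψi, hψs⟩ := hS f hf i hi
  set g := f - (f i / ψ i) • ψ with hg
  have hgs : SemiInvariant χ g := fun σ j => by
    simp only [hg, Pi.sub_apply, Pi.smul_apply, smul_eq_mul, hf σ j, hψ σ j]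
    ring
  have hgi : g i = 0 := by simp [hg, hψi]
  have hsub : Function.support g ⊆ Function.support f := by
    intro j hgj hfj
    have hψj : ψ j ≠ 0 := fun h => hgj (by simp [hg, h, hfj])
    obtain ⟨σ, rfl⟩ := exists_perm_comp_eq (hψs j hψj)
    have hχ : χ σ ≠ 0 := fun h => hψj (by rw [hψ, h, zero_mul])
    exact mul_ne_zero hχ hi (hf σ i ▸ hfj)
  have hlt : (Function.support g).ncard < m := hs ▸ Set.ncard_lt_ncard
    ⟨hsub, fun h => h hi hgi⟩ (Set.toFinite _)
  have := S.add_mem (ih _ hlt hgs rfl) (S.smul_mem (f i / ψ i) hψS)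
  rwa [hg, sub_add_cancel] at this

/-- The set partition of `Fin k` into the fibers of `i`. -/
def kerPartition {k n : ℕ} (i : Fin k → Fin n) :
    Finpartition (Finset.univ : Finset (Fin k)) :=
  Finpartition.ofSetoid (Setoid.ker i)

lemma mem_part_kerPartition {k n : ℕ} (i : Fin k → Fin n) (a b : Fin k) :
    b ∈ (kerPartition i).part a ↔ i a = i b :=
  Finpartition.mem_part_ofSetoid_iff_rel

lemma kerPartition_perm_comp {k n : ℕ} (σ : Equiv.Perm (Fin n)) (i : Fin k → Fin n) :
    kerPartition (σ ∘ i) = kerPartition i := by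
  have h : Setoid.ker (σ ∘ i) = Setoid.ker i := Setoid.ext fun a b => by simp [Setoid.ker_def]
  unfold kerPartition
  congr!

lemma constOnBlocks_iff_le_kerPartition {k n : ℕ}
    (P : Finpartition (Finset.univ : Finset (Fin k))) (i : Fin k → Fin n) :
    constOnBlocks P i ↔ P ≤ kerPartition i := by
  constructor
  · intro h B hB
    obtain ⟨a, ha⟩ := P.nonempty_of_mem_parts hB
    exact ⟨_, (kerPartition i).part_mem.2 (Finset.mem_univ a), fun b hb =>
      (mem_part_kerPartition i a b).2 (h a b ⟨B, hB, ha, hb⟩)⟩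
  · rintro h a b ⟨B, hB, ha, hb⟩
    obtain ⟨C, hC, hBC⟩ := h hB
    rw [← mem_part_kerPartition, (kerPartition i).part_eq_of_mem hC (hBC ha)]
    exact hBC hb

/-- By Möbius inversion, a submodule containing the coefficient functions of all `Φ_P` contains
the indicator function of the tuples with kernel `P`. -/
lemma indicator_kerPartition_mem {𝕜 : Type*} [Field 𝕜] {k n : ℕ}
    {S : Submodule 𝕜 ((Fin k → Fin n) → 𝕜)}
    (hS : ∀ P : Finpartition (Finset.univ : Finset (Fin k)),
      (fun i => if constOnBlocks P i then (1 : 𝕜) else 0) ∈ S)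
    (P : Finpartition (Finset.univ : Finset (Fin k))) :
    (fun i => if kerPartition i = P then (1 : 𝕜) else 0) ∈ S := by
  induction P using WellFoundedGT.induction with
  | _ P ih =>
  have h : (fun i : Fin k → Fin n => if kerPartition i = P then (1 : 𝕜) else 0) =
      (fun i => if constOnBlocks P i then (1 : 𝕜) else 0) -
        ∑ Q with P < Q, fun i => if kerPartition i = Q then (1 : 𝕜) else 0 := by
    funext i
    simp only [Pi.sub_apply, Finset.sum_apply, Finset.sum_ite_eq, Finset.mem_filter,
      Finset.mem_univ, true_and, constOnBlocks_iff_le_kerPartition, le_iff_lt_or_eq]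
    by_cases h₁ : P = kerPartition i
    · simp [← h₁]
    · simp [h₁, Ne.symm h₁]
  rw [h]
  exact S.sub_mem (hS P) (S.sum_mem fun Q hQ => ih Q (Finset.mem_filter.1 hQ).2)

lemma invariant_mem {𝕜 : Type*} [Field 𝕜] {k n : ℕ} {S : Submodule 𝕜 ((Fin k → Fin n) → 𝕜)}
    (hS : ∀ P : Finpartition (Finset.univ : Finset (Fin k)),
      (fun i => if constOnBlocks P i then (1 : 𝕜) else 0) ∈ S)
    {f : (Fin k → Fin n) → 𝕜} (hf : SemiInvariant 1 f) : f ∈ S := by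
  refine SemiInvariant.mem_of_orbit (fun _ _ i _ => ?_) hf
  refine ⟨_, indicator_kerPartition_mem hS (kerPartition i), fun σ j => ?_, ?_, fun j hj a b => ?_⟩
  · simp [kerPartition_perm_comp]
  · simp
  · have h : kerPartition j = kerPartition i := by by_contra h; simp [h] at hj
    rw [← mem_part_kerPartition i, ← mem_part_kerPartition j, h]

/-- A sign-equivariant function vanishes on tuples missing at least two values. -/
lemma SemiInvariant.pred_le_card_range {𝕜 ι : Type*} [Field 𝕜] (h2 : (2 : 𝕜) ≠ 0) {n : ℕ}
    {f : (ι → Fin n) → 𝕜} (hf : SemiInvariant (fun σ => ((Equiv.Perm.sign σ : ℤ) : 𝕜)) f)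
    {i : ι → Fin n} (hi : f i ≠ 0) : n - 1 ≤ Nat.card (Set.range i) := by
  by_contra! h
  have hc : 1 < (Set.range i)ᶜ.ncard := by
    have := Set.ncard_add_ncard_compl (Set.range i)
    rw [Nat.card_fin, ← Nat.card_coe_set_eq] at this
    omega
  obtain ⟨a, b, ha, hb, hab⟩ := (Set.one_lt_ncard_iff (Set.toFinite _)).1 hc
  have hfix : Equiv.swap a b ∘ i = i := funext fun x =>
    Equiv.swap_apply_of_ne_of_ne (fun h => ha ⟨x, h⟩) (fun h => hb ⟨x, h⟩)
  have := hf (Equiv.swap a b) i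
  simp only [hfix, Equiv.Perm.sign_swap hab] at this
  refine mul_ne_zero h2 hi ?_
  push_cast at this
  linear_combination this

lemma DET_perm_comp {𝕜 : Type*} [Field 𝕜] {n : ℕ} (σ : Equiv.Perm (Fin n)) (i : Fin n → Fin n) :
    (DET (σ ∘ i) : 𝕜) = (Equiv.Perm.sign σ : ℤ) * DET i := by
  have := Matrix.det_permute σ⁻¹ (Matrix.of fun a b => if i b = a then (1 : 𝕜) else 0)
  rw [Equiv.Perm.sign_inv] at this
  rw [DET, DET, ← this]
  congr 1
  ext a b
  simp [Equiv.eq_symm_apply]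

lemma Mmat_det_perm_comp {𝕜 : Type*} [Field 𝕜] {k n : ℕ} (r : Fin (n - 1) → Fin k)
    (σ : Equiv.Perm (Fin n)) (i : Fin k → Fin n) :
    (Mmat r (σ ∘ i) : Matrix _ _ 𝕜).det = (Equiv.Perm.sign σ : ℤ) * (Mmat r i).det := by
  have := Matrix.det_permute σ⁻¹ (Mmat r i : Matrix _ _ 𝕜)
  rw [Equiv.Perm.sign_inv] at this
  rw [← this]
  congr 1
  ext a b
  simp [Mmat, Equiv.eq_symm_apply]

lemma injective_of_DET_ne_zero {𝕜 : Type*} [Field 𝕜] {n : ℕ} {i : Fin n → Fin n}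
    (h : (DET i : 𝕜) ≠ 0) : Function.Injective i := fun a b hab => by
  by_contra hne
  exact h (Matrix.det_zero_of_column_eq hne (by simp [hab]))

lemma DET_id {𝕜 : Type*} [Field 𝕜] {n : ℕ} : (DET (id : Fin n → Fin n) : 𝕜) = 1 := by
  rw [DET, ← Matrix.det_one (n := Fin n)]
  congr 1
  ext a b
  simp [Matrix.one_apply, eq_comm]

lemma injective_of_Mmat_det_ne_zero {𝕜 : Type*} [Field 𝕜] {k n : ℕ} {r : Fin (n - 1) → Fin k}
    {i : Fin k → Fin n} (h : (Mmat r i : Matrix _ _ 𝕜).det ≠ 0) :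
    Function.Injective (i ∘ r) := fun a b hab => by
  by_contra hne
  have hab' : i (r a) = i (r b) := hab
  refine h (Matrix.det_zero_of_column_eq (i := ⟨a, by omega⟩) (j := ⟨b, by omega⟩)
    (by simpa [Fin.ext_iff] using hne) ?_)
  simp [Mmat, hab']

lemma Mmat_det_ne_zero {𝕜 : Type*} [Field 𝕜] {k n : ℕ} (hn : 0 < n) {r : Fin (n - 1) → Fin k}
    {i : Fin k → Fin n} (h : Function.Injective (i ∘ r)) :
    (Mmat r i : Matrix _ _ 𝕜).det ≠ 0 := by
  intro h0
  obtain ⟨v, hv, hvM⟩ := Matrix.exists_vecMul_eq_zero_iff.2 h0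
  have hcol (c : Fin (n - 1)) : v (i (r c)) = 0 := by
    have := congrFun hvM ⟨c, by omega⟩
    simpa [Matrix.vecMul, dotProduct, Mmat] using this
  have hsum : ∑ a, v a = 0 := by
    have := congrFun hvM ⟨n - 1, by omega⟩
    simpa [Matrix.vecMul, dotProduct, Mmat] using this
  have hcard : (Set.range (i ∘ r))ᶜ.ncard = 1 := by
    have := Set.ncard_add_ncard_compl (Set.range (i ∘ r))
    rw [Nat.card_fin, ← Set.image_univ, Set.ncard_image_of_injective _ h, Set.ncard_univ,
      Nat.card_fin, Set.image_univ] at this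
    omega
  obtain ⟨x, hx⟩ := Set.ncard_eq_one.1 hcard
  have hne (a : Fin n) (ha : a ≠ x) : v a = 0 := by
    have : a ∈ Set.range (i ∘ r) := by
      by_contra hmem
      exact ha (hx.subset hmem)
    obtain ⟨c, rfl⟩ := this
    exact hcol c
  refine hv (funext fun a => ?_)
  by_cases ha : a = x
  · rw [ha, ← Finset.sum_eq_single_of_mem x (Finset.mem_univ x) fun b _ hb => hne b hb, hsum]
    rfl
  · exact hne a ha

/-- If a tuple `j` is constant on the fibers of `p` and injective on a section of `p`, then `j`
and `p` have the same kernel. -/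
lemma eq_iff_eq_of_section {α β γ : Type*} {p : α → β} {r : β → α} {j : α → γ}
    (hr : p ∘ r = id) (hj : ∀ a b, p a = p b → j a = j b) (hjr : Function.Injective (j ∘ r))
    (a b : α) : p a = p b ↔ j a = j b := by
  refine ⟨hj a b, fun h => hjr ?_⟩
  have hp (x : α) : j (r (p x)) = j x := hj _ _ (congrFun hr (p x))
  simp only [Function.comp_apply, hp, h]

lemma signInvariant_mem {𝕜 : Type*} [Field 𝕜] (h2 : (2 : 𝕜) ≠ 0) {k n : ℕ} (hn : 0 < n)
    {S : Submodule 𝕜 ((Fin k → Fin n) → 𝕜)}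
    (hJ : ∀ (p : Fin k → Fin n) (r : Fin n → Fin k), Function.Surjective p → p ∘ r = id →
      (fun i => if ∀ a b : Fin k, p a = p b → i a = i b then (DET (i ∘ r) : 𝕜) else 0) ∈ S)
    (hJ' : ∀ (p : Fin k → Fin (n - 1)) (r : Fin (n - 1) → Fin k), Function.Surjective p →
      p ∘ r = id → (fun i => if ∀ a b : Fin k, p a = p b → i a = i b then
        (Mmat r i : Matrix _ _ 𝕜).det else 0) ∈ S)
    {f : (Fin k → Fin n) → 𝕜}
    (hf : SemiInvariant (fun σ => ((Equiv.Perm.sign σ : ℤ) : 𝕜)) f) : f ∈ S := by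
  refine SemiInvariant.mem_of_orbit (fun g hg i hi => ?_) hf
  have hcard := hg.pred_le_card_range h2 hi
  rcases hcard.eq_or_lt with hc | hc
  · let e : Set.range i ≃ Fin (n - 1) := Finite.equivFinOfCardEq hc.symm
    let p : Fin k → Fin (n - 1) := fun a => e ⟨i a, a, rfl⟩
    have hp : Function.Surjective p := e.surjective.comp Set.rangeFactorization_surjective
    have hr : p ∘ Function.surjInv hp = id := funext (Function.surjInv_eq hp)
    have hpi (a b : Fin k) : p a = p b ↔ i a = i b :=
      e.injective.eq_iff.trans Subtype.ext_iff
    refine ⟨_, hJ' p _ hp hr, fun σ j => ?_, ?_, fun j hj a b => ?_⟩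
    · simp [Mmat_det_perm_comp]
    · rw [if_pos fun a b => (hpi a b).1]
      refine Mmat_det_ne_zero hn fun c d hcd => ?_
      simpa [Function.surjInv_eq] using (hpi _ _).2 hcd
    · have h : ∀ a b, p a = p b → j a = j b := by by_contra h; simp [h] at hj
      rw [← hpi]
      exact eq_iff_eq_of_section hr h (injective_of_Mmat_det_ne_zero (by rwa [if_pos h] at hj)) a b
  · have hp : Function.Surjective i := by
      rw [← Set.range_eq_univ]
      refine Set.eq_of_subset_of_ncard_le (Set.subset_univ _) ?_
      rw [Set.ncard_univ, Nat.card_fin, ← Nat.card_coe_set_eq]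
      omega
    have hr : i ∘ Function.surjInv hp = id := funext (Function.surjInv_eq hp)
    refine ⟨_, hJ i _ hp hr, fun σ j => ?_, ?_, fun j hj a b => ?_⟩
    · simp [Function.comp_assoc, DET_perm_comp]
    · simp [hr, DET_id]
    · have h : ∀ a b, i a = i b → j a = j b := by by_contra h; simp [h] at hj
      exact eq_iff_eq_of_section hr h (injective_of_DET_ne_zero (by rwa [if_pos h] at hj)) a b

/-- Over a field of characteristic not two, a function on tuples invariant under even permutations
is the sum of an invariant and a sign-equivariant one. -/
lemma exists_add_of_alternating_invariant {𝕜 ι : Type*} [Field 𝕜] (h2 : (2 : 𝕜) ≠ 0) {n : ℕ}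
    {f : (ι → Fin n) → 𝕜}
    (hf : ∀ σ ∈ alternatingGroup (Fin n), ∀ j, f (σ ∘ j) = f j) :
    ∃ g h, SemiInvariant 1 g ∧ SemiInvariant (fun σ => ((Equiv.Perm.sign σ : ℤ) : 𝕜)) h ∧
      f = g + h := by
  by_cases hodd : ∃ τ : Equiv.Perm (Fin n), Equiv.Perm.sign τ = -1
  · obtain ⟨τ, hτ⟩ := hodd
    have hσ_odd (σ : Equiv.Perm (Fin n)) (hσ : Equiv.Perm.sign σ = -1) (j : ι → Fin n) :
        f (σ ∘ j) = f (τ ∘ j) := by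
      have := hf (σ * τ⁻¹) (by simp [Equiv.Perm.mem_alternatingGroup, hσ, hτ]) (τ ∘ j)
      simpa [← Function.comp_assoc, ← Equiv.Perm.coe_mul] using this
    have hτσ_odd (σ : Equiv.Perm (Fin n)) (hσ : Equiv.Perm.sign σ = -1) (j : ι → Fin n) :
        f (τ ∘ σ ∘ j) = f j :=
      hf (τ * σ) (by simp [Equiv.Perm.mem_alternatingGroup, hσ, hτ]) j
    have hτσ_even (σ : Equiv.Perm (Fin n)) (hσ : Equiv.Perm.sign σ = 1) (j : ι → Fin n) :
        f (τ ∘ σ ∘ j) = f (τ ∘ j) :=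
      hσ_odd (τ * σ) (by simp [hσ, hτ]) j
    refine ⟨fun j => (f j + f (τ ∘ j)) / 2, fun j => (f j - f (τ ∘ j)) / 2,
      fun σ j => ?_, fun σ j => ?_, ?_⟩
    · rcases Int.units_eq_one_or (Equiv.Perm.sign σ) with hσ | hσ
      · simp [hτσ_even σ hσ, hf σ (Equiv.Perm.mem_alternatingGroup.2 hσ)]
      · simp [hτσ_odd σ hσ, hσ_odd σ hσ, add_comm]
    · rcases Int.units_eq_one_or (Equiv.Perm.sign σ) with hσ | hσ
      · simp [hσ, hτσ_even σ hσ, hf σ (Equiv.Perm.mem_alternatingGroup.2 hσ)]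
      · simp only [hσ, hτσ_odd σ hσ, hσ_odd σ hσ]
        push_cast
        ring
    · funext j
      simp only [Pi.add_apply]
      field_simp
      ring
  · refine ⟨f, 0, fun σ j => ?_, fun σ j => by simp, by simp⟩
    have hσ := (Int.units_eq_one_or (Equiv.Perm.sign σ)).resolve_right fun h => hodd ⟨σ, h⟩
    simpa using hf σ (Equiv.Perm.mem_alternatingGroup.2 hσ) j

lemma permAct_single {𝕜 : Type*} [Field 𝕜] {k n : ℕ} (σ : Equiv.Perm (Fin n))
    (i : Fin k → Fin n) :
    permAct σ (Pi.single i (1 : 𝕜)) = Pi.single (σ ∘ i) 1 := by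
  funext j
  have : σ.symm ∘ j = i ↔ j = σ ∘ i := by
    rw [Equiv.symm_comp_eq]
  simp [permAct, Pi.single_apply, this]

end Jellyfish

/-- every linear functional on `W_k` invariant under the alternating group
is a `𝕜`-linear combination of the functionals `Φ_P`, `J_{p,r}` and `J'_{p,r}`. -/
theorem statement0 (𝕜 : Type*) [Field 𝕜] (hchar : ringChar 𝕜 ≠ 2)
    (n k : ℕ) (hn : 0 < n)
    (φ : ((Fin k → Fin n) → 𝕜) →ₗ[𝕜] 𝕜)
    (hφ : ∀ σ : Equiv.Perm (Fin n), σ ∈ alternatingGroup (Fin n) →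
      ∀ g : (Fin k → Fin n) → 𝕜, φ (permAct σ g) = φ g) :
    φ ∈ Submodule.span 𝕜
      {ψ : ((Fin k → Fin n) → 𝕜) →ₗ[𝕜] 𝕜 |
        (∃ P : Finpartition (Finset.univ : Finset (Fin k)), ψ = PhiP P) ∨
        (∃ (p : Fin k → Fin n) (r : Fin n → Fin k),
          Function.Surjective p ∧ p ∘ r = id ∧ ψ = Jf p r) ∨
        (∃ (p : Fin k → Fin (n - 1)) (r : Fin (n - 1) → Fin k),
          Function.Surjective p ∧ p ∘ r = id ∧ ψ = Jf' p r)} := by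
  have h2 : (2 : 𝕜) ≠ 0 := Ring.two_ne_zero hchar
  let L := Fintype.linearCombination 𝕜
    (fun i => (LinearMap.proj i : ((Fin k → Fin n) → 𝕜) →ₗ[𝕜] 𝕜))
  have hL : φ = L (fun i => φ (Pi.single i 1)) := by
    ext i
    simp [L, Fintype.linearCombination_apply, Pi.single_apply]
  rw [hL, ← Submodule.mem_comap]
  obtain ⟨g, h, hg, hh, hgh⟩ := exists_add_of_alternating_invariant h2
    (f := fun i => φ (Pi.single i 1)) fun σ hσ j => by rw [← permAct_single, hφ σ hσ]
  rw [hgh]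
  refine Submodule.add_mem _ (invariant_mem (fun P => ?_) hg)
    (signInvariant_mem h2 hn (fun p r hp hr => ?_) (fun p r hp hr => ?_) hh)
  · exact Submodule.subset_span (Or.inl ⟨P, rfl⟩)
  · exact Submodule.subset_span (Or.inr (Or.inl ⟨p, r, hp, hr, rfl⟩))
  · exact Submodule.subset_span (Or.inr (Or.inr ⟨p, r, hp, hr, rfl⟩))
end
end

section
/- For all tuples i, j : Fin n → Fin n, DET i · DET j = Σ_{σ ∈ Perm (Fin n)} sign(σ) · Π_{m : Fin n} (if i (σ m) = j m then 1 else 0), where the sum is over all permutations σ of Fin n and sign denotes the sign of a permutation. (This is part (3) of the proposition on relations for det: det ⊗ det = Φ(Σ_σ (−1)^σ ⋒_n ∘ (σ ⊗ 1_n)), the jellyfish relation evaluated on basis vectors.) -/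
open scoped Classical

noncomputable section

open Jellyfish

/-- `DET i · DET j = Σ_σ sign(σ) · Π_m [i (σ m) = j m]`. -/
theorem statement7 (𝕜 : Type*) [Field 𝕜] (hchar : ringChar 𝕜 ≠ 2)
    (n : ℕ) (hn : 0 < n) (i j : Fin n → Fin n) :
    (DET i : 𝕜) * DET j =
      ∑ σ : Equiv.Perm (Fin n), ((Equiv.Perm.sign σ : ℤ) : 𝕜) *
        ∏ m : Fin n, (if i (σ m) = j m then (1 : 𝕜) else 0) := by
  unfold DET
  rw [← Matrix.det_transpose (Matrix.of fun a b => if i b = a then (1 : 𝕜) else 0),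
    ← Matrix.det_mul, Matrix.det_apply']
  refine Finset.sum_congr rfl fun σ _ => ?_
  congr 1
  refine Finset.prod_congr rfl fun m _ => ?_
  simp [Matrix.mul_apply, eq_comm]
end
end

section
/- Assume n ≥ 2, and let i : Fin k → Fin n be a tuple whose range has at least n − 1 elements. Then the Perm (Fin n)-orbit of i is the disjoint union of exactly two alternating-group orbits: for every odd permutation σ₀ ∈ Perm (Fin n), there is no even permutation τ with τ ∘ i = σ₀ ∘ i, and every element of the Perm (Fin n)-orbit of i lies either in the alternating-group orbit of i or in the alternating-group orbit of σ₀ ∘ i. -/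
open scoped Classical

noncomputable section

open Jellyfish

/-- A permutation of `Fin n` is determined by its values on any `n - 1` points. -/
theorem perm_eq_of_comp_eq {ι : Type*} [Fintype ι] {n : ℕ} (i : ι → Fin n)
    (hcard : n - 1 ≤ (Finset.univ.image i).card) {σ τ : Equiv.Perm (Fin n)}
    (h : ⇑τ ∘ i = ⇑σ ∘ i) : τ = σ := by
  rw [← inv_mul_eq_one, ← Equiv.Perm.card_support_le_one]
  have hdisj : Disjoint (τ⁻¹ * σ).support (Finset.univ.image i) := by
    rw [Finset.disjoint_right]
    simp only [Finset.mem_image, Finset.mem_univ, true_and]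
    rintro _ ⟨x, rfl⟩
    have hx : τ (i x) = σ (i x) := congrFun h x
    simp [← hx]
  have hle := Finset.card_le_univ ((τ⁻¹ * σ).support ∪ Finset.univ.image i)
  rw [Finset.card_union_of_disjoint hdisj, Fintype.card_fin] at hle
  omega

/-- if the range of `i` has at least `n - 1` elements, its
`Perm (Fin n)`-orbit is the disjoint union of exactly two alternating-group orbits. -/
theorem statement11 (𝕜 : Type*) [Field 𝕜] (hchar : ringChar 𝕜 ≠ 2)
    (n k : ℕ) (hn : 2 ≤ n) (i : Fin k → Fin n)
    (hcard : n - 1 ≤ (Finset.univ.image i).card)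
    (σ₀ : Equiv.Perm (Fin n)) (hσ₀ : Equiv.Perm.sign σ₀ = -1) :
    (¬ ∃ τ ∈ alternatingGroup (Fin n), ⇑τ ∘ i = ⇑σ₀ ∘ i) ∧
    (∀ i' : Fin k → Fin n, (∃ σ : Equiv.Perm (Fin n), ⇑σ ∘ i = i') →
      (∃ τ ∈ alternatingGroup (Fin n), ⇑τ ∘ i = i') ∨
      (∃ τ ∈ alternatingGroup (Fin n), ⇑τ ∘ (⇑σ₀ ∘ i) = i')) := by
  have mem {σ : Equiv.Perm (Fin n)} (h : Equiv.Perm.sign σ = 1) : σ ∈ alternatingGroup (Fin n) :=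
    Equiv.Perm.mem_alternatingGroup.2 h
  refine ⟨?_, ?_⟩
  · rintro ⟨τ, hτ, h⟩
    rw [perm_eq_of_comp_eq i hcard h, Equiv.Perm.mem_alternatingGroup, hσ₀] at hτ
    exact absurd hτ (by decide)
  · rintro i' ⟨σ, rfl⟩
    rcases Int.units_eq_one_or (Equiv.Perm.sign σ) with h | h
    · exact Or.inl ⟨σ, mem h, rfl⟩
    · refine Or.inr ⟨σ * σ₀⁻¹, mem (by simp [h, hσ₀]), ?_⟩
      funext x
      simp
end
end

section
/- Assume n ≥ 2, let p : Fin k → Fin (n−1) be a surjection and r : Fin (n−1) → Fin k a section of p (p ∘ r = id). Then the functional J'_{p,r} satisfies: (1) J'_{p,r}(δ_{σ ∘ i}) = sign(σ) · J'_{p,r}(δ_i) for every σ ∈ Perm (Fin n) and every tuple i : Fin k → Fin n; and (2) if the kernel of i equals the kernel of p (∀ a b, i a = i b ↔ p a = p b) then J'_{p,r}(δ_i) = 1 or J'_{p,r}(δ_i) = −1, while otherwise J'_{p,r}(δ_i) = 0. (This is the proposition on the jellyfish functionals Ψ(j_D) for partition diagrams D with exactly n − 1 parts, where the jellyfish has one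 dangling leg.) -/
open scoped Classical

noncomputable section

namespace Jellyfish

variable {𝕜 : Type*} [Field 𝕜] {k n : ℕ}

theorem Jf'_delta (p : Fin k → Fin (n - 1)) (r : Fin (n - 1) → Fin k) (i : Fin k → Fin n) :
    Jf' p r (delta i) =
      if ∀ a b : Fin k, p a = p b → i a = i b then (Mmat r i).det else (0 : 𝕜) := by
  simp only [Jf', delta, LinearMap.sum_apply, LinearMap.smul_apply, LinearMap.proj_apply,
    smul_eq_mul, mul_ite, mul_one, mul_zero, Finset.sum_ite_eq', Finset.mem_univ, if_true]

theorem Mmat_perm_comp (r : Fin (n - 1) → Fin k) (σ : Equiv.Perm (Fin n)) (i : Fin k → Fin n) :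
    (Mmat r (⇑σ ∘ i) : Matrix (Fin n) (Fin n) 𝕜) = (Mmat r i).submatrix ⇑σ⁻¹ id := by
  ext a b
  simp [Mmat, ← Equiv.eq_symm_apply, Equiv.Perm.inv_def]

theorem det_Mmat_perm_comp (r : Fin (n - 1) → Fin k) (σ : Equiv.Perm (Fin n))
    (i : Fin k → Fin n) :
    (Mmat r (⇑σ ∘ i)).det = ((Equiv.Perm.sign σ : ℤ) : 𝕜) * (Mmat r i).det := by
  rw [Mmat_perm_comp, Matrix.det_permute, Equiv.Perm.sign_inv]

theorem det_Mmat_of_initial (r : Fin (n - 1) → Fin k) (i : Fin k → Fin n)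
    (h : ∀ c, i (r c) = Fin.castLE n.pred_le c) : (Mmat r i).det = (1 : 𝕜) := by
  rw [Matrix.det_of_isUpperTriangular]
  · refine Finset.prod_eq_one fun a _ => ?_
    by_cases ha : (a : ℕ) < n - 1 <;> simp [Mmat, ha, h, Fin.ext_iff]
  · intro a b hab
    have hlt : (b : ℕ) < a := hab
    have hb : (b : ℕ) < n - 1 := by omega
    simp [Mmat, hb, h, Fin.ext_iff, hlt.ne]

theorem exists_perm_extending_initial (f : Fin (n - 1) → Fin n) (hf : Function.Injective f) :
    ∃ τ : Equiv.Perm (Fin n), ∀ c, τ (f c) = Fin.castLE n.pred_le c := by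
  let e := (Equiv.ofInjective f hf).symm.trans
    (Equiv.ofInjective _ (Fin.castLE_injective n.pred_le))
  refine ⟨e.extendSubtype, fun c => ?_⟩
  rw [Equiv.extendSubtype_apply_of_mem e (f c) ⟨c, rfl⟩]
  simp [e, Equiv.ofInjective_symm_apply]

theorem det_Mmat_of_injective (r : Fin (n - 1) → Fin k) (i : Fin k → Fin n)
    (h : Function.Injective (i ∘ r)) :
    (Mmat r i).det = (1 : 𝕜) ∨ (Mmat r i).det = (-1 : 𝕜) := by
  obtain ⟨τ, hτ⟩ := exists_perm_extending_initial _ h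
  have hdet := det_Mmat_perm_comp (𝕜 := 𝕜) r τ i
  rw [det_Mmat_of_initial r (⇑τ ∘ i) hτ] at hdet
  rcases Int.units_eq_one_or (Equiv.Perm.sign τ) with hs | hs
  · left
    simpa [hs] using hdet.symm
  · right
    simp only [hs, Units.val_neg, Units.val_one, Int.cast_neg, Int.cast_one] at hdet
    linear_combination hdet

theorem det_Mmat_of_not_injective (r : Fin (n - 1) → Fin k) (i : Fin k → Fin n)
    (h : ¬ Function.Injective (i ∘ r)) : (Mmat r i).det = (0 : 𝕜) := by
  obtain ⟨c, d, hcd, hne⟩ := Function.not_injective_iff.mp h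
  refine Matrix.det_zero_of_column_eq (i := Fin.castLE n.pred_le c) (j := Fin.castLE n.pred_le d)
    (fun heq => hne (Fin.castLE_injective _ heq)) fun a => ?_
  have hcd' : i (r c) = i (r d) := hcd
  simp [Mmat, hcd']

end Jellyfish

open Jellyfish

/-- properties of the jellyfish functional `J'_{p,r}` for a surjection
`p : Fin k → Fin (n-1)` with section `r`. -/
theorem statement13 (𝕜 : Type*) [Field 𝕜] (hchar : ringChar 𝕜 ≠ 2)
    (n k : ℕ) (hn : 2 ≤ n) (p : Fin k → Fin (n - 1)) (r : Fin (n - 1) → Fin k)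
    (hp : Function.Surjective p) (hpr : p ∘ r = id) :
    (∀ (σ : Equiv.Perm (Fin n)) (i : Fin k → Fin n),
      Jf' p r (delta (⇑σ ∘ i)) = ((Equiv.Perm.sign σ : ℤ) : 𝕜) * Jf' p r (delta i)) ∧
    (∀ i : Fin k → Fin n,
      ((∀ a b : Fin k, i a = i b ↔ p a = p b) →
        (Jf' p r (delta i) = (1 : 𝕜) ∨ Jf' p r (delta i) = (-1 : 𝕜))) ∧
      (¬ (∀ a b : Fin k, i a = i b ↔ p a = p b) → Jf' p r (delta i) = (0 : 𝕜))) := by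
  have hpr' (c) : p (r c) = c := congrFun hpr c
  refine ⟨fun σ i => ?_, fun i => ⟨fun h => ?_, fun h => ?_⟩⟩
  · simp only [Jf'_delta, Function.comp_apply, σ.injective.eq_iff, det_Mmat_perm_comp]
    split_ifs <;> simp
  · rw [Jf'_delta, if_pos fun a b => (h a b).mpr]
    refine det_Mmat_of_injective r i fun c d hcd => ?_
    simpa only [hpr'] using (h (r c) (r d)).mp hcd
  · rw [Jf'_delta]
    split_ifs with hconst
    · refine det_Mmat_of_not_injective r i fun hinj => h fun a b => ⟨fun hab => ?_, hconst a b⟩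
      have hrp (x) : i (r (p x)) = i x := hconst _ _ (hpr' _)
      exact hinj (by simp only [Function.comp_apply, hrp, hab])
    · rfl
end
end
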